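/- Let F_8 be the field with 8 elements and Ω_9 = ℙ¹(F_8) the projective line over F_8 (a 9-element set). Let G_9 ≤ Sym(Ω_9) be the subgroup generated by the image of the natural action homomorphism GL_2(F_8) → Sym(Ω_9) together with the permutation of Ω_9 induced by the Frobenius automorphism x ↦ x² of F_8 applied to homogeneous coordinates ([a:b] ↦ [a²:b²]); thus G_9 ≅ PΓL(2,8). For every n ≥ 9, identify S_n with the symmetric group on the disjoint union Ω = Ω_9 ⊔ {10,…,n}, and let G_9 × S_{n−9} be the subgroup of permutations of Ω mapping Ω_9 to itself whose restriction to Ω_9 lies in G_9. Then the permutation character of S_n on the cosets of G_9 × S_{n−9} is multiplicity-free. -/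

import Mathlib

/-- The permutation character of `G` on the cosets of `H` is multiplicity-free:
every irreducible complex representation of `G` has at most a one-dimensional
subspace of `H`-fixed vectors. -/
noncomputable def IsMultFree {G : Type} [Group G] (H : Subgroup G) : Prop :=
  ∀ V : FDRep ℂ G, CategoryTheory.Simple V →
    Module.finrank ℂ (Representation.invariants (V.ρ.comp H.subtype)) ≤ 1

/-- The field with 8 elements. -/
noncomputable abbrev F8 := GaloisField 2 3

/-- The permutation of the projective space `ℙ K V` induced by a linear automorphism of `V`. -/
noncomputable def projPerm {K V : Type*} [Field K] [AddCommGroup V] [Module K V]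
    (e : V ≃ₗ[K] V) : Equiv.Perm (Projectivization K V) where
  toFun := Projectivization.map (e : V →ₗ[K] V) e.injective
  invFun := Projectivization.map (e.symm : V →ₗ[K] V) e.symm.injective
  left_inv x := by
    induction x using Projectivization.ind with
    | h v hv => simp [Projectivization.map_mk]
  right_inv x := by
    induction x using Projectivization.ind with
    | h v hv => simp [Projectivization.map_mk]

/-- The action of the group of linear automorphisms of `V` on `ℙ K V`, as a homomorphism
to the symmetric group of `ℙ K V`. -/
noncomputable def projAutHom (K V : Type*) [Field K] [AddCommGroup V] [Module K V] :
    (V ≃ₗ[K] V) →* Equiv.Perm (Projectivization K V) where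
  toFun := projPerm
  map_one' := by
    ext x
    induction x using Projectivization.ind with
    | h v hv => simp [projPerm, Projectivization.map_mk]
  map_mul' e f := by
    ext x
    induction x using Projectivization.ind with
    | h v hv => simp [projPerm, Projectivization.map_mk]; rfl

/-- The natural action homomorphism `GL₂(F₈) → Sym(ℙ¹(F₈))`. -/
noncomputable def glProjHom8 :
    Matrix.GeneralLinearGroup (Fin 2) F8 →*
      Equiv.Perm (Projectivization F8 (Fin 2 → F8)) :=
  (projAutHom F8 (Fin 2 → F8)).comp
    (((LinearMap.GeneralLinearGroup.generalLinearEquiv F8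
        (Fin 2 → F8)).toMonoidHom).comp
      (Matrix.GeneralLinearGroup.toLin :
        Matrix.GeneralLinearGroup (Fin 2) F8 ≃*
          LinearMap.GeneralLinearGroup F8 (Fin 2 → F8)).toMonoidHom)

/-- The Frobenius `x ↦ x²` of `F₈` applied to homogeneous coordinates, as a semilinear
endomorphism of `F₈²`. -/
noncomputable def frobSL : (Fin 2 → F8) →ₛₗ[frobenius F8 2] (Fin 2 → F8) where
  toFun v := fun i => v i ^ 2
  map_add' a b := by
    funext i
    simp [add_pow_char]
  map_smul' c v := by
    funext i
    simp [frobenius_def, mul_pow, smul_eq_mul]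

/-- The inverse of the Frobenius applied to homogeneous coordinates, as a semilinear
endomorphism of `F₈²`. -/
noncomputable def frobInvSL :
    (Fin 2 → F8) →ₛₗ[((frobeniusEquiv F8 2).symm : F8 →+* F8)] (Fin 2 → F8) where
  toFun v := fun i => (frobeniusEquiv F8 2).symm (v i)
  map_add' a b := by
    funext i
    simp
  map_smul' c v := by
    funext i
    simp [smul_eq_mul, map_mul]

lemma frobInvSL_frobSL (v : Fin 2 → F8) : frobInvSL (frobSL v) = v := by
  funext i
  simp [frobSL, frobInvSL, ← frobenius_def, frobeniusEquiv_symm_apply_frobenius]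

lemma frobSL_frobInvSL (v : Fin 2 → F8) : frobSL (frobInvSL v) = v := by
  funext i
  simp [frobSL, frobInvSL, ← frobenius_def, frobenius_apply_frobeniusEquiv_symm]

lemma frobSL_injective : Function.Injective frobSL := by
  intro a b h
  funext i
  have h' := congrFun h i
  exact (frobenius F8 2).injective (by simpa [frobSL, frobenius_def] using h')

lemma frobInvSL_injective : Function.Injective frobInvSL := by
  intro a b h
  funext i
  have h' := congrFun h i
  exact (frobeniusEquiv F8 2).symm.injective (by simpa [frobInvSL] using h')

/-- The permutation of the projective line `ℙ¹(F₈)` induced by the Frobenius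
automorphism `x ↦ x²` on homogeneous coordinates: `[a : b] ↦ [a² : b²]`. -/
noncomputable def frobProjPerm : Equiv.Perm (Projectivization F8 (Fin 2 → F8)) where
  toFun := Projectivization.map frobSL frobSL_injective
  invFun := Projectivization.map frobInvSL frobInvSL_injective
  left_inv x := by
    induction x using Projectivization.ind with
    | h v hv => simp [Projectivization.map_mk, frobInvSL_frobSL]
  right_inv x := by
    induction x using Projectivization.ind with
    | h v hv => simp [Projectivization.map_mk, frobSL_frobInvSL]

/-- `G₉ ≅ PΓL(2,8)`: the subgroup of the symmetric group on `ℙ¹(F₈)` generated by the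
image of `GL₂(F₈)` together with the permutation induced by the Frobenius. -/
noncomputable def pgammal28 : Subgroup (Equiv.Perm (Projectivization F8 (Fin 2 → F8))) :=
  Subgroup.closure ((glProjHom8.range : Set _) ∪ {frobProjPerm})

open CategoryTheory in
/-- A nonzero invariant subspace of a simple finite-dimensional representation is everything. -/
lemma FDRep.eq_top_of_simple {k G : Type} [Field k] [Group G] (V : FDRep k G) [Simple V]
    (W : Submodule k V) (hW : ∀ g, ∀ w ∈ W, V.ρ g w ∈ W) (hW0 : W ≠ ⊥) : W = ⊤ := by
  let σ : Representation k G W := Subrepresentation.toRepresentation ⟨W, fun g v hv => hW g v hv⟩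
  let f : FDRep.of σ ⟶ V :=
    ⟨InducedCategory.homMk (ModuleCat.ofHom W.subtype), fun g => by ext; rfl⟩
  have hinj : Function.Injective f := Subtype.val_injective
  have : Mono f := ConcreteCategory.mono_of_injective f hinj
  have hf : f ≠ 0 := by
    intro h0
    obtain ⟨w, hw, hw0⟩ := W.ne_bot_iff.mp hW0
    have : f ⟨w, hw⟩ = (0 : FDRep.of σ ⟶ V) ⟨w, hw⟩ := by rw [h0]
    exact hw0 this
  have := isIso_of_mono_of_nonzero hf
  rw [eq_top_iff]
  intro v _
  have hv : f (inv f v) = v := by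
    rw [← ConcreteCategory.comp_apply, IsIso.inv_hom_id, ConcreteCategory.id_apply]
  rw [← hv]
  exact Subtype.property (p := (· ∈ W)) (inv f v)

section Gelfand

variable {G A : Type*} [Group G] [Ring A] (ρ : G →* A) (H : Subgroup G) [Fintype H]

/-- The sum of the operators `ρ h` for `h ∈ H`. -/
def subgroupSum : A := ∑ h : H, ρ h

lemma subgroupSum_mul {h : G} (hh : h ∈ H) : subgroupSum ρ H * ρ h = subgroupSum ρ H := by
  rw [subgroupSum, Finset.sum_mul]
  exact Fintype.sum_equiv (Equiv.mulRight (⟨h, hh⟩ : H)) _ (fun x : H => ρ x) fun x => by simp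

lemma mul_subgroupSum {h : G} (hh : h ∈ H) : ρ h * subgroupSum ρ H = subgroupSum ρ H := by
  rw [subgroupSum, Finset.mul_sum]
  exact Fintype.sum_equiv (Equiv.mulLeft (⟨h, hh⟩ : H)) _ (fun x : H => ρ x) fun x => by simp

/-- **Gelfand's trick**: if every double coset of `H` is closed under inversion, then the
Hecke operators of `H` commute. -/
lemma hecke_comm (hH : ∀ g : G, ∃ h₁ ∈ H, ∃ h₂ ∈ H, h₁ * g * h₂ = g⁻¹) (a b : G) :
    subgroupSum ρ H * ρ a * subgroupSum ρ H * ρ b * subgroupSum ρ H =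
      subgroupSum ρ H * ρ b * subgroupSum ρ H * ρ a * subgroupSum ρ H := by
  set E := subgroupSum ρ H with hE
  have hinv (g : G) : E * ρ g⁻¹ * E = E * ρ g * E := by
    obtain ⟨h₁, hh₁, h₂, hh₂, h⟩ := hH g
    calc E * ρ g⁻¹ * E = (E * ρ h₁) * ρ g * (ρ h₂ * E) := by rw [← h]; simp [mul_assoc]
      _ = E * ρ g * E := by rw [hE, subgroupSum_mul ρ H hh₁, mul_subgroupSum ρ H hh₂]
  have expand (a b : G) : E * ρ a * E * ρ b * E = ∑ h : H, E * ρ (a * h * b) * E := by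
    conv_lhs => enter [1, 1, 2]; rw [hE, subgroupSum]
    simp [Finset.mul_sum, Finset.sum_mul, mul_assoc]
  calc E * ρ a * E * ρ b * E = E * ρ b⁻¹ * E * ρ a⁻¹ * E := by
        rw [expand, expand]
        exact Fintype.sum_equiv (Equiv.inv H) _ _ fun x => by rw [← hinv]; simp [mul_assoc]
    _ = E * ρ b * (E * ρ a⁻¹ * E) := by rw [hinv]; simp only [mul_assoc]
    _ = E * ρ b * E * ρ a * E := by rw [hinv]; simp only [mul_assoc]

end Gelfand

/-- If every double coset of `H` is closed under inversion, then an irreducible representation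
has at most a line of `H`-fixed vectors. -/
lemma finrank_invariants_le_one {k G V : Type*} [Field k] [IsAlgClosed k] [CharZero k] [Group G]
    [AddCommGroup V] [Module k V] [FiniteDimensional k V] (ρ : Representation k G V)
    (hρ : ∀ W : Submodule k V, (∀ g, ∀ w ∈ W, ρ g w ∈ W) → W ≠ ⊥ → W = ⊤)
    (H : Subgroup G) [Finite H] (hH : ∀ g : G, ∃ h₁ ∈ H, ∃ h₂ ∈ H, h₁ * g * h₂ = g⁻¹) :
    Module.finrank k (Representation.invariants (ρ.comp H.subtype)) ≤ 1 := by
  have := Fintype.ofFinite H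
  set S := Representation.invariants (ρ.comp H.subtype)
  set E : Module.End k V := subgroupSum ρ H with hE
  set c : k := (Fintype.card H : k)
  have hc : c ≠ 0 := by simp [c]
  have hES (v : V) : E v ∈ S := fun h => by
    change (ρ h * E) v = E v
    rw [hE, mul_subgroupSum ρ H h.2]
  have hEv (v : V) (hv : v ∈ S) : E v = c • v := by
    have (h : H) : ρ h v = v := hv h
    simp [hE, subgroupSum, LinearMap.sum_apply, this, c, Nat.cast_smul_eq_nsmul]
  have hcomm (a b : G) (v : V) (hv : v ∈ S) : E (ρ a (E (ρ b v))) = E (ρ b (E (ρ a v))) := by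
    have h := LinearMap.congr_fun (hecke_comm ρ H hH a b) v
    simp only [← hE, Module.End.mul_apply, hEv v hv, map_smul] at h
    exact smul_right_injective V hc h
  have hspan (v : V) (hv0 : v ≠ 0) :
      S ≤ Submodule.span k (Set.range fun g => E (ρ g v)) := by
    have htop : Submodule.span k (Set.range fun g => ρ g v) = ⊤ := by
      apply hρ
      · intro g w hw
        have : Submodule.span k (Set.range fun g => ρ g v) ≤
            (Submodule.span k (Set.range fun g => ρ g v)).comap (ρ g) := by
          rw [Submodule.span_le]
          rintro _ ⟨x, rfl⟩
          exact Submodule.subset_span ⟨g * x, by simp⟩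
        exact this hw
      · exact Submodule.ne_bot_iff _ |>.mpr ⟨v, Submodule.subset_span ⟨1, by simp⟩, hv0⟩
    intro w hw
    have hw' : E w ∈ (Submodule.span k (Set.range fun g => ρ g v)).map E :=
      ⟨w, htop ▸ Submodule.mem_top, rfl⟩
    rw [Submodule.map_span, ← Set.range_comp, hEv w hw] at hw'
    exact (Submodule.smul_mem_iff _ hc).mp hw'
  rcases subsingleton_or_nontrivial S with hS | hS
  · simp [Module.finrank_zero_of_subsingleton]
  have hscalar (a : G) : ∃ μ : k, ∀ w ∈ S, E (ρ a w) = μ • w := by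
    obtain ⟨μ, hμ⟩ := Module.End.exists_eigenvalue
      ((E * ρ a).restrict (p := S) (q := S) fun v _ => hES _)
    obtain ⟨v, hv⟩ := hμ.exists_hasEigenvector
    have hv1 : E (ρ a v) = μ • (v : V) := congrArg Subtype.val hv.apply_eq_smul
    have hv0 : (v : V) ≠ 0 := fun h => hv.2 (Subtype.ext h)
    refine ⟨μ, fun w hw => ?_⟩
    have hw' := hspan v hv0 hw
    clear hw
    induction hw' using Submodule.span_induction with
    | mem x hx => obtain ⟨g, rfl⟩ := hx; simp only [hcomm a g v v.2, hv1, map_smul]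
    | zero => simp
    | add x y _ _ hx hy => simp [hx, hy]
    | smul r x _ hx => simp [hx, smul_comm r μ]
  obtain ⟨v, hv⟩ := exists_ne (0 : S)
  refine finrank_le_one v fun w => ?_
  have hle : Submodule.span k (Set.range fun g => E (ρ g v)) ≤ Submodule.span k {(v : V)} := by
    rw [Submodule.span_le]
    rintro _ ⟨g, rfl⟩
    obtain ⟨μ, hμ⟩ := hscalar g
    simpa only [SetLike.mem_coe, hμ v v.2] using
      Submodule.smul_mem _ _ (Submodule.mem_span_singleton_self _)
  obtain ⟨r, hr⟩ := Submodule.mem_span_singleton.mp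
    (hle (hspan v (fun h => hv (Subtype.ext h)) w.2))
  exact ⟨r, Subtype.ext hr⟩

lemma isMultFree_of_inv_mem_doubleCoset {G : Type} [Group G] (H : Subgroup G) [Finite H]
    (hH : ∀ g : G, ∃ h₁ ∈ H, ∃ h₂ ∈ H, h₁ * g * h₂ = g⁻¹) : IsMultFree H := fun V _ =>
  finrank_invariants_le_one V.ρ (FDRep.eq_top_of_simple V) H hH

section PermutationsOfTheLine

open Equiv

/-- A partial injection of a finite type into itself extends to a permutation. -/
lemma Set.InjOn.exists_perm_extend {α : Type*} [Finite α] {s : Set α} {f : α → α}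
    (hf : s.InjOn f) : ∃ σ : Perm α, ∀ a ∈ s, σ a = f a := by
  classical
  have := Fintype.ofFinite α
  obtain ⟨g, hg⟩ := Set.MapsTo.exists_equiv_extend_of_card_eq (t := Finset.univ)
    (Finset.card_univ (α := α)).symm (s := s) (f := f) (fun _ _ => by simp) hf
  exact ⟨g.trans (Equiv.subtypeUnivEquiv Finset.mem_univ), hg⟩

/-- Two permutations of `α ⊕ β` with the same restriction to `α`, as partial maps from `α` to
itself, differ by permutations of `β`. -/
lemma exists_sumCongr_mul_mul_sumCongr_eq {α β : Type*} [Finite α] [Finite β] (p q : Perm (α ⊕ β))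
    (hpq : ∀ a, p (.inl a) = q (.inl a) ∨ ∃ c d, p (.inl a) = .inr c ∧ q (.inl a) = .inr d) :
    ∃ σ τ : Perm β, sumCongr 1 σ * p * sumCongr 1 τ = q := by
  classical
  let f (c : β) : β := Sum.elim (fun _ => c) id (q (p.symm (.inr c)))
  let D : Set β := {c | ∃ a, p (.inl a) = .inr c}
  have hf : ∀ c ∈ D, .inr (f c) = q (p.symm (.inr c)) := by
    rintro c ⟨a, ha⟩
    have hc : p.symm (.inr c) = .inl a := by rw [← ha]; simp
    obtain h | ⟨c', d, h₁, h₂⟩ := hpq a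
    · simp [f, hc, ← h, ha]
    · simp [f, hc, h₂]
  have hinj : D.InjOn f := fun c hc d hd h => by
    have h' := congrArg (Sum.inr (α := α)) h
    rw [hf c hc, hf d hd] at h'
    simpa using h'
  obtain ⟨σ, hσ⟩ := hinj.exists_perm_extend
  have key (a : α) : sumCongr 1 σ (p (.inl a)) = q (.inl a) := by
    obtain h | ⟨c, d, h₁, h₂⟩ := hpq a
    · rcases hb : p (.inl a) with b | c
      · rw [← h, hb]; rfl
      · have hc : c ∈ D := ⟨a, hb⟩
        have := hf c hc
        rw [← hb] at this
        simp [hσ c hc, this]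
    · have hc : c ∈ D := ⟨a, h₁⟩
      have := hf c hc
      rw [← h₁] at this
      rw [h₁]
      simp [hσ c hc, this]
  have hfix (a : α) : (p⁻¹ * (sumCongr 1 σ)⁻¹ * q : Perm (α ⊕ β)) (.inl a) = .inl a := by
    simp [Perm.mul_apply, ← key a]
  obtain ⟨⟨τ₁, τ⟩, hτ⟩ := Perm.mem_sumCongrHom_range_of_perm_mapsTo_inl
    (σ := p⁻¹ * (sumCongr 1 σ)⁻¹ * q) (by rintro _ ⟨a, rfl⟩; exact ⟨a, (hfix a).symm⟩)
  have hτ₁ : τ₁ = 1 := by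
    ext a
    have := hfix a
    rw [← hτ] at this
    simpa using this
  refine ⟨σ, τ, ?_⟩
  have : sumCongr 1 τ = p⁻¹ * (sumCongr 1 σ)⁻¹ * q := by rw [← hτ, hτ₁]; rfl
  rw [this]
  group

/-- The partial map obtained by restricting `x` to `A` can be carried to its inverse by
multiplying with elements of `G` on both sides. -/
def ReversibleOn {α : Type*} (G : Subgroup (Perm α)) (x : Perm α) (A : Set α) : Prop :=
  ∃ u ∈ G, ∃ v ∈ G, ∀ a ∈ A, v (x a) ∈ A ∧ u (x (v (x a))) = a

/-- If all restrictions of permutations are reversible with respect to `G`, then the double cosets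
of `G × Sym β` in `Sym (α ⊕ β)` are closed under inversion. -/
lemma exists_mul_mul_eq_inv_of_reversibleOn {α β : Type*} [Finite α] [Finite β]
    (G : Subgroup (Perm α)) (hG : ∀ x A, ReversibleOn G x A) (g : Perm (α ⊕ β)) :
    ∃ h₁ ∈ (G.prod (⊤ : Subgroup (Perm β))).map (Perm.sumCongrHom α β),
    ∃ h₂ ∈ (G.prod (⊤ : Subgroup (Perm β))).map (Perm.sumCongrHom α β), h₁ * g * h₂ = g⁻¹ := by
  let f (a : α) : α := Sum.elim id (fun _ => a) (g (.inl a))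
  let A : Set α := {a | ∃ b, g (.inl a) = .inl b}
  have hf : ∀ a ∈ A, .inl (f a) = g (.inl a) := by
    rintro a ⟨b, hb⟩
    simp [f, hb]
  have hinj : A.InjOn f := fun a ha b hb h => by
    have h' := congrArg (Sum.inl (β := β)) h
    rw [hf a ha, hf b hb] at h'
    simpa using h'
  obtain ⟨x, hx⟩ := hinj.exists_perm_extend
  have hgx : ∀ a ∈ A, g (.inl a) = .inl (x a) := fun a ha => by rw [hx a ha, hf a ha]
  obtain ⟨u, hu, v, hv, huv⟩ := hG x A
  have hmaps : Set.MapsTo (v * x) A A := fun a ha => (huv a ha).1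
  have hmaps' := Perm.perm_symm_mapsTo_of_mapsTo _ hmaps
  obtain ⟨σ, τ, hστ⟩ := exists_sumCongr_mul_mul_sumCongr_eq
    (sumCongr u 1 * g * sumCongr v 1) g⁻¹ fun b => by
      by_cases hb : ∃ a ∈ A, x a = b
      · obtain ⟨a, ha, rfl⟩ := hb
        left
        rw [Perm.eq_inv_iff_eq]
        simp [Perm.mul_apply, hgx _ (huv a ha).1, (huv a ha).2, hgx a ha]
      · right
        have hvb : v b ∉ A := fun h =>
          hb ⟨_, hmaps' h, v.injective ((v * x).apply_symm_apply (v b))⟩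
        rcases hc : g (.inl (v b)) with b' | c
        · exact (hvb ⟨b', hc⟩).elim
        rcases hd : g.symm (.inl b) with a | d
        · have hga : g (.inl a) = .inl b := by rw [← hd]; simp
          have ha : a ∈ A := ⟨b, hga⟩
          exact (hb ⟨a, ha, by simpa [hgx a ha] using hga⟩).elim
        · exact ⟨c, d, by simp [Perm.mul_apply, hc], rfl⟩
  refine ⟨sumCongr u σ, ⟨(u, σ), ⟨hu, trivial⟩, rfl⟩,
    sumCongr v τ, ⟨(v, τ), ⟨hv, trivial⟩, rfl⟩, ?_⟩
  rw [← hστ]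
  have h₁ : sumCongr u σ = sumCongr 1 σ * sumCongr u 1 := by rw [Perm.sumCongr_mul]; simp
  have h₂ : sumCongr v τ = sumCongr v 1 * sumCongr 1 τ := by rw [Perm.sumCongr_mul]; simp
  rw [h₁, h₂]
  simp only [mul_assoc]

/-- The decimal digit of `n` at position `i`, reduced modulo 9. A numeral with digits
`n₈ … n₁ n₀` encodes the self-map `i ↦ nᵢ` of `Fin 9`. -/
def digit (n i : ℕ) : ℕ := n / 10 ^ i % 10 % 9

/-- The self-map of `Fin 9` encoded by a numeral. -/
def digitMap (n : ℕ) (i : Fin 9) : Fin 9 := ⟨digit n i, Nat.mod_lt _ (by norm_num)⟩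

/-- Permutations of the projective line over `F₈`, where `i < 7` stands for `[αⁱ : 1]` with
`α³ = α + 1`, `7` for `[0 : 1]` and `8` for `[1 : 0]`: the identity, the multiplications by
`α, …, α⁶`, the Frobenius, `z ↦ z + 1` and `z ↦ z⁻¹`. -/
def letters : List ℕ :=
  [876543210, 870654321, 871065432, 872106543, 873210654, 874321065, 875432106, 875316420,
    802451637, 781234560]

/-- The product of the `letters` indexed by the last `n` digits of `w`; the last digit acts
first. -/
def wordMap : ℕ → ℕ → ℕ → ℕ
  | 0, _, i => i
  | n + 1, w, i => wordMap n (w / 10) (digit (letters.getD (w % 10) 0) i)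

/-- The transposition of `a` and `b`. -/
def swapNat (a b i : ℕ) : ℕ := if i = a then b else if i = b then a else i

/-- Whether the triple `c = (j, u, v)` witnesses `(a b) ∘ r = u ∘ s ∘ v` on `{0, …, k - 1}`, where
`v` preserves this set and `s` is the `j`-th entry of `reps`. -/
def isCertificate (k : ℕ) (reps : List ℕ) (r a b : ℕ) (c : ℕ × ℕ × ℕ) : Bool :=
  match reps[c.1]? with
  | none => false
  | some r' => (List.range k).all fun i =>
      decide (wordMap 8 c.2.2 i < k) &&
        wordMap 8 c.2.1 (digit r' (wordMap 8 c.2.2 i)) == swapNat a b (digit r i)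

/-- Whether `certs` contains, for each entry of `reps` and each transposition, a certificate. -/
def checkCertificates (k : ℕ) (reps : List ℕ) (certs : List (List (ℕ × ℕ × ℕ))) : Bool :=
  (reps.zip certs).all fun rc => (List.range 9).all fun b => (List.range b).all fun a =>
    isCertificate k reps rc.1 a b (rc.2.getD (b * (b - 1) / 2 + a) (0, 0, 0))

/-- Whether `r` encodes an involution of `{0, …, k - 1}`. -/
def isInvolution (k r : ℕ) : Bool :=
  (List.range k).all fun i => decide (digit r i < k) && digit r (digit r i) == i

/-- Whether `reps` is a list of involutions of `{0, …, k - 1}`, starting with the identity, that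
`certs` certifies to be closed under transpositions up to the group generated by `letters`. -/
def checkReps (k : ℕ) (reps : List ℕ) (certs : List (List (ℕ × ℕ × ℕ))) : Bool :=
  reps.contains 876543210 && reps.length == certs.length && reps.all (isInvolution k) &&
    checkCertificates k reps certs

section Reps

variable {G : Subgroup (Perm (Fin 9))}

lemma exists_mem_eq_wordMap (hG : ∀ d < 10, ∃ g ∈ G, ∀ i, g i = digitMap (letters.getD d 0) i)
    (n w : ℕ) : ∃ g ∈ G, ∀ i : Fin 9, (g i : ℕ) = wordMap n w i := by
  induction n generalizing w with
  | zero => exact ⟨1, G.one_mem, fun i => rfl⟩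
  | succ n ih =>
    obtain ⟨g, hg, hgi⟩ := ih (w / 10)
    obtain ⟨l, hl, hli⟩ := hG (w % 10) (Nat.mod_lt _ (by norm_num))
    exact ⟨g * l, G.mul_mem hg hl, fun i => by rw [Perm.mul_apply, hgi, hli]; rfl⟩

lemma val_swap_eq_swapNat (a b i : Fin 9) : (swap a b i : ℕ) = swapNat a b i := by
  simp only [swap_apply_def, swapNat, Fin.ext_iff]
  split_ifs <;> rfl

lemma exists_swap_digitMap_eq
    (hG : ∀ d < 10, ∃ g ∈ G, ∀ i, g i = digitMap (letters.getD d 0) i)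
    {k r : ℕ} {reps : List ℕ} {a b : Fin 9} {c : ℕ × ℕ × ℕ}
    (h : isCertificate k reps r a b c = true) :
    ∃ u ∈ G, ∃ v ∈ G, ∃ r' ∈ reps, ∀ i : Fin 9, (i : ℕ) < k →
      (v i : ℕ) < k ∧ swap a b (digitMap r i) = u (digitMap r' (v i)) := by
  unfold isCertificate at h
  split at h
  · simp at h
  rename_i r' hr'
  obtain ⟨u, hu, hui⟩ := exists_mem_eq_wordMap hG 8 c.2.1
  obtain ⟨v, hv, hvi⟩ := exists_mem_eq_wordMap hG 8 c.2.2
  refine ⟨u, hu, v, hv, r', List.mem_of_getElem? hr', fun i hi => ?_⟩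
  have h := List.all_eq_true.mp h i (List.mem_range.mpr hi)
  simp only [Bool.and_eq_true, decide_eq_true_eq, beq_iff_eq] at h
  refine ⟨by rw [hvi]; exact h.1, Fin.ext ?_⟩
  rw [val_swap_eq_swapNat, hui]
  simp only [digitMap, hvi]
  exact h.2.symm

lemma exists_isCertificate {k : ℕ} {reps : List ℕ} {certs : List (List (ℕ × ℕ × ℕ))}
    (h : checkReps k reps certs = true) {r : ℕ} (hr : r ∈ reps) {a b : Fin 9} (hab : a < b) :
    ∃ c, isCertificate k reps r a b c = true := by
  simp only [checkReps, checkCertificates, Bool.and_eq_true, beq_iff_eq] at h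
  obtain ⟨j, hj, rfl⟩ := List.mem_iff_getElem.mp hr
  have hj' : j < certs.length := h.1.1.2 ▸ hj
  have hmem : (reps[j], certs[j]) ∈ reps.zip certs :=
    List.mem_iff_getElem.mpr ⟨j, by simp [hj, hj'], by simp⟩
  have := List.all_eq_true.mp (List.all_eq_true.mp (List.all_eq_true.mp h.2 _ hmem) b
    (List.mem_range.mpr b.2)) a (List.mem_range.mpr hab)
  exact ⟨_, this⟩

/-- On `{0, …, k - 1}`, every permutation is the product of an element of `reps` with elements of
`G` on both sides. -/
lemma exists_eq_mul_digitMap_mul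
    (hG : ∀ d < 10, ∃ g ∈ G, ∀ i, g i = digitMap (letters.getD d 0) i)
    {k : ℕ} {reps : List ℕ} {certs : List (List (ℕ × ℕ × ℕ))}
    (h : checkReps k reps certs = true) (x : Perm (Fin 9)) :
    ∃ u ∈ G, ∃ v ∈ G, ∃ r ∈ reps, ∀ i : Fin 9, (i : ℕ) < k →
      (v i : ℕ) < k ∧ x i = u (digitMap r (v i)) := by
  induction x using Perm.swap_induction_on with
  | one =>
    refine ⟨1, G.one_mem, 1, G.one_mem, 876543210, ?_, fun i hi => ⟨hi, ?_⟩⟩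
    · simp only [checkReps, Bool.and_eq_true] at h
      simpa using h.1.1.1
    · have : ∀ i, digitMap 876543210 i = i := by decide
      simp [this]
  | swap_mul f a b hab ih =>
    obtain ⟨u, hu, v, hv, r, hr, huv⟩ := ih
    obtain ⟨u', hu', v', hv', r', hr', huv'⟩ : ∃ u' ∈ G, ∃ v' ∈ G, ∃ r' ∈ reps, ∀ i : Fin 9,
        (i : ℕ) < k → (v' i : ℕ) < k ∧
          swap (u⁻¹ a) (u⁻¹ b) (digitMap r i) = u' (digitMap r' (v' i)) := by
      rcases lt_or_gt_of_ne (u⁻¹.injective.ne hab) with hlt | hlt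
      · obtain ⟨c, hc⟩ := exists_isCertificate h hr hlt
        exact exists_swap_digitMap_eq hG hc
      · obtain ⟨c, hc⟩ := exists_isCertificate h hr hlt
        rw [swap_comm]
        exact exists_swap_digitMap_eq hG hc
    refine ⟨u * u', G.mul_mem hu hu', v' * v, G.mul_mem hv' hv, r', hr', fun i hi => ?_⟩
    obtain ⟨hi₁, hi₂⟩ := huv i hi
    obtain ⟨hi₃, hi₄⟩ := huv' (v i) hi₁
    refine ⟨hi₃, ?_⟩
    rw [Perm.mul_apply, Perm.mul_apply, Perm.mul_apply, hi₂, ← hi₄, swap_apply_apply]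
    simp

/-- If the sets `{0, …, k - 1}` have certified lists of involutions, then all restrictions of
permutations of `Fin 9` are reversible. -/
lemma reversibleOn_of_checkReps
    (hG : ∀ d < 10, ∃ g ∈ G, ∀ i, g i = digitMap (letters.getD d 0) i)
    (hreps : ∀ k ≤ 9, ∃ reps certs, checkReps k reps certs = true)
    (x : Perm (Fin 9)) (A : Set (Fin 9)) : ReversibleOn G x A := by
  classical
  obtain ⟨k, hk⟩ : ∃ k, Fintype.card A = k := ⟨_, rfl⟩
  have hk9 : k ≤ 9 := hk ▸ (Fintype.card_subtype_le (· ∈ A))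
  obtain ⟨reps, certs, h⟩ := hreps k hk9
  have hinv : ∀ r ∈ reps, ∀ i : Fin 9, (i : ℕ) < k →
      (digitMap r i : ℕ) < k ∧ digitMap r (digitMap r i) = i := fun r hr i hi => by
    simp only [checkReps, Bool.and_eq_true] at h
    have := List.all_eq_true.mp (List.all_eq_true.mp h.1.2 r hr) i (List.mem_range.mpr hi)
    simp only [Bool.and_eq_true, decide_eq_true_eq, beq_iff_eq] at this
    exact ⟨this.1, Fin.ext this.2⟩
  have hpres {v : Perm (Fin 9)} (hv : ∀ i : Fin 9, (i : ℕ) < k → (v i : ℕ) < k) (i : Fin 9)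
      (hi : (i : ℕ) < k) : (v.symm i : ℕ) < k :=
    Perm.perm_symm_mapsTo_of_mapsTo v (s := {i | (i : ℕ) < k}) hv hi
  have e : {i : Fin 9 // (i : ℕ) < k} ≃ {i // i ∈ A} := Fintype.equivOfCardEq <| by
    rw [hk, Fintype.card_subtype, Fin.card_filter_val_lt, min_eq_right hk9]
  obtain ⟨u₀, hu₀, v₀, -, r₀, hr₀, huv₀⟩ := exists_eq_mul_digitMap_mul hG h e.extendSubtype
  have hA : ∀ a ∈ A, (u₀.symm a : ℕ) < k := fun a ha => by
    obtain ⟨⟨i, hi⟩, hia⟩ := e.surjective ⟨a, ha⟩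
    have hea : e.extendSubtype i = a := by rw [e.extendSubtype_apply_of_mem i hi, hia]
    rw [← hea, (huv₀ i hi).2]
    simpa using (hinv r₀ hr₀ _ (huv₀ i hi).1).1
  have hA' : ∀ i : Fin 9, (i : ℕ) < k → u₀ i ∈ A := fun j hj => by
    set i := v₀.symm (digitMap r₀ j)
    have hi : (i : ℕ) < k := hpres (fun i hi => (huv₀ i hi).1) _ (hinv r₀ hr₀ j hj).1
    have : e.extendSubtype i = u₀ j := by
      rw [(huv₀ i hi).2]
      simp [i, (hinv r₀ hr₀ j hj).2]
    rw [← this]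
    exact e.extendSubtype_mem i hi
  obtain ⟨u, hu, v, hv, r, hr, huv⟩ := exists_eq_mul_digitMap_mul hG h (x * u₀)
  have hvu : v⁻¹ * u⁻¹ ∈ G := G.mul_mem (G.inv_mem hv) (G.inv_mem hu)
  refine ⟨u₀ * (v⁻¹ * u⁻¹), G.mul_mem hu₀ hvu, u₀ * (v⁻¹ * u⁻¹), G.mul_mem hu₀ hvu, fun a ha => ?_⟩
  obtain ⟨b, rfl⟩ := u₀.surjective a
  have hb : (b : ℕ) < k := by simpa using hA _ ha
  obtain ⟨hb₁, hb₂⟩ := huv b hb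
  rw [Perm.mul_apply] at hb₂
  obtain ⟨hr₁, hr₂⟩ := hinv r hr _ hb₁
  have hj := hpres (fun i hi => (huv i hi).1) _ hr₁
  have hj₂ := (huv _ hj).2
  rw [Perm.mul_apply] at hj₂
  have hxb : (u₀ * (v⁻¹ * u⁻¹)) (x (u₀ b)) = u₀ (v.symm (digitMap r (v b))) := by
    simp [Perm.mul_apply, hb₂]
  rw [hxb, hj₂]
  exact ⟨hA' _ hj, by simp [hr₂]⟩

end Reps

/-- The lists of involutions and the certificates, depending on `k`, to which `checkReps`
applies. -/
def certifiedReps : ℕ → List ℕ × List (List (ℕ × ℕ × ℕ))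
  | 4 =>
    ([876543210, 876542310],
     [[(1,94,94), (1,93873,0), (1,0,489871), (1,0,93873), (1,489871,0), (1,0,0),
        (1,8971,0), (1,18928772,0), (0,91871,0), (1,3892,0), (0,48968771,0), (0,938773,0),
        (0,689771,0), (0,38968772,0), (0,0,0), (1,589582,0), (0,48973,0), (1,48772,0),
        (1,5873,0), (0,0,0), (0,0,0), (0,6895873,0), (1,584,94), (1,6896872,0),
        (1,4877,94), (0,0,0), (0,0,0), (0,0,0), (1,91877,0), (1,5894876,0), (1,9284,0),
        (0,5895874,0), (0,0,0), (0,0,0), (0,0,0), (0,0,0)],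
      [(0,0,489183), (0,0,93873), (0,0,6898773), (0,0,489773), (0,0,489871), (0,0,0),
        (0,8971,0), (0,18928772,0), (1,91871,0), (0,3892,0), (1,482,6873), (1,938773,0),
        (1,689771,0), (1,38968772,0), (1,0,0), (0,589582,0), (1,48973,0), (0,48772,0),
        (0,5873,0), (1,0,0), (1,0,0), (1,48975,94), (0,689181,0), (0,6896872,0),
        (0,58938771,0), (1,0,0), (1,0,0), (1,0,0), (0,91877,0), (0,5894876,0), (0,9284,0),
        (1,5895874,0), (1,0,0), (1,0,0), (1,0,0), (1,0,0)]])
  | 5 =>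
    ([876543210, 876534210, 876542310, 876534120],
     [[(1,93,93), (2,6872,58771), (2,93,93), (1,0,6872), (1,92872,0), (2,0,0), (1,6872,0),
        (1,0,92872), (2,58771,6872), (1,0,0), (3,1,68971), (3,975,589871), (2,9582,6872),
        (3,68972,0), (2,481,589772), (2,981,58771), (3,589872,93), (2,282,68971),
        (3,7,92872), (3,928771,0), (0,0,0), (3,589182,0), (3,689582,92872), (2,6896872,0),
        (2,58938771,0), (3,584,918771), (0,0,0), (0,0,0), (3,9877,92872), (2,68918775,93),
        (2,5892874,93), (3,589387,918771), (3,68938,93), (0,0,0), (0,0,0), (0,0,0)],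
      [(0,0,689581), (3,68971,589871), (3,0,0), (0,0,58771), (0,0,92872), (3,93,589482),
        (0,0,6872), (0,0,589772), (3,589482,93), (0,0,0), (2,8971,6872), (2,75,58771),
        (3,28972,93), (2,6871,93), (3,4892,68971), (3,8982,589871), (2,582,6872),
        (3,2891,918771), (2,3892,0), (2,6,918771), (1,0,0), (2,89381,93), (2,68776,0),
        (3,289776,92872), (3,389681,92872), (2,5896,68971), (1,0,0), (1,0,0), (2,58987,0),
        (3,18938775,0), (3,2896876,0), (2,68958,58771), (2,91877,6872), (1,0,0), (1,0,0),
        (1,0,0)],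
      [(3,93,93), (3,93,589871), (3,92872,0), (3,6898772,93), (3,0,589772), (0,0,0),
        (3,92872,93), (3,93,68971), (3,93,589482), (3,589482,93), (1,1,68971),
        (2,9681,68971), (3,6891,6898772), (2,68981,93), (3,481,92872), (3,5892,918771),
        (1,1871,0), (3,282,689581), (2,7,589772), (2,93872,93), (2,0,0), (2,589773,93),
        (2,5876,6872), (0,689,6872), (0,58938771,0), (2,6873,68971), (2,0,0), (2,0,0),
        (2,589183,6872), (3,68985,0), (3,58948773,0), (2,38984,589482), (1,9284,0),
        (2,0,0), (2,0,0), (2,0,0)],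
      [(2,589482,93), (2,93,589482), (1,0,0), (2,589772,93), (2,0,92872), (2,93,6872),
        (2,68971,93), (2,58771,93), (2,589772,0), (2,93,93), (3,8971,589482),
        (3,75,589871), (2,28981,0), (0,68972,0), (2,4891872,0), (2,71,68971),
        (3,1871,92872), (2,9282,68971), (3,3891872,93), (0,928771,0), (3,0,0),
        (0,589182,0), (3,186,93), (2,683,589772), (2,585,689581), (3,489182,918771),
        (3,0,0), (3,0,0), (3,58948774,93), (1,18938775,0), (1,2896876,0),
        (3,68958,589871), (3,9284,92872), (3,0,0), (3,0,0), (3,0,0)]])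
  | 6 =>
    ([876543210, 876453210, 876534210, 876452310, 876534120, 876451230],
     [[(1,92,92), (2,74,776), (2,92,92), (1,975,6871), (1,681,681), (2,689771,91871),
        (2,9773,975), (2,68971,918771), (1,74,776), (2,0,0), (2,6891,9181), (2,776,74),
        (1,0,91871), (2,975,9773), (1,0,0), (3,81,6891), (3,1871,689771), (3,958771,6871),
        (3,38771,68971), (3,93871,68771), (3,9281,681), (3,68948771,74), (3,689181,0),
        (3,286,68981), (3,6892871,776), (3,48776,689871), (3,5876,6898771), (0,0,0),
        (3,9876,918771), (3,968776,91871), (3,6896876,9773), (3,9486,9181), (3,689386,92),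
        (3,68958776,975), (0,0,0), (0,0,0)],
      [(5,0,68971), (3,918771,68971), (3,68971,918771), (5,68971,0), (5,0,0), (3,0,0),
        (3,6891,776), (3,776,6891), (0,0,91871), (3,91871,91871), (3,74,9181),
        (3,9181,74), (0,0,689771), (3,689771,689771), (0,0,0), (2,9771,918771),
        (2,9,689771), (4,95871,6891), (2,973,776), (4,48981,681), (4,928771,0),
        (2,6876,74), (2,68776,91871), (4,28774,776), (2,382,975), (4,4874,689771),
        (4,584,918771), (1,0,0), (2,689482,92), (2,689876,0), (4,289285,6871),
        (2,6898776,9181), (4,68938774,74), (4,6895874,68971), (1,0,0), (1,0,0)],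
      [(3,689871,6898771), (2,68771,74), (4,0,0), (3,681,6898771), (3,9773,6898771),
        (3,91871,0), (3,689871,681), (3,689871,975), (3,0,689771), (0,0,0), (4,681,681),
        (2,6871,776), (3,91871,689771), (3,91871,91871), (3,689771,689771),
        (3,8981,689871), (1,9,91871), (4,281,68771), (3,9772,68981), (3,4898771,9773),
        (2,58971,975), (4,83,776), (2,18976,91871), (3,289281,68971), (3,38968771,918771),
        (3,68977,6891), (1,584,9773), (2,0,0), (3,8985,776), (2,918772,9773),
        (3,289285,68771), (4,6898,6871), (4,918,74), (2,6898772,918771), (2,0,0),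
        (2,0,0)],
      [(4,776,975), (4,776,6898771), (4,776,681), (4,689871,74), (4,681,74), (1,0,0),
        (3,9181,975), (3,975,9181), (2,0,91871), (2,6898771,9773), (3,9773,6891),
        (3,6891,9773), (2,975,689871), (2,689771,0), (2,689771,91871), (2,971,68981),
        (3,1898771,91871), (3,3,6898771), (3,4,689871), (3,48771,918771), (4,589871,776),
        (4,872,6871), (0,68,9181), (4,2893,0), (4,686,68971), (3,6873,68971),
        (3,589481,6871), (3,0,0), (3,689482,68771), (3,689876,689771), (2,2898,74),
        (2,6898,6898771), (5,68982,74), (2,689873,975), (3,0,0), (3,0,0)],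
      [(3,9181,9773), (3,975,6891), (2,0,0), (3,689771,9773), (3,74,9773), (4,74,975),
        (3,975,91871), (4,776,9773), (3,975,776), (2,92,92), (5,6871,0), (3,74,689871),
        (3,6898771,776), (3,74,681), (3,681,776), (2,891,776), (3,181,918771),
        (4,28771,91871), (4,3898771,68971), (3,9381,6898771), (2,58981,9773),
        (3,689772,975), (3,185,92), (4,6875,689771), (1,68972,0), (2,48,74),
        (3,5877,68771), (4,0,0), (3,9877,689771), (2,968,975), (1,68983,681),
        (4,91875,68771), (3,9385,0), (3,6898772,74), (4,0,0), (4,0,0)],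
      [(1,0,918771), (4,689871,689771), (4,681,74), (1,74,74), (1,0,0), (4,776,681),
        (4,68771,0), (4,74,68771), (1,975,681), (4,68981,68971), (4,0,6871),
        (4,6898771,6891), (1,92,975), (4,6871,776), (1,681,681), (3,891,6898771),
        (3,18971,68981), (3,2898771,74), (3,389771,689871), (3,489871,0), (3,58981,776),
        (3,8958771,6871), (3,189381,68771), (3,2893,689771), (3,3896871,681),
        (3,489773,68971), (3,58973,6891), (5,0,0), (3,89873,92), (3,1898773,975),
        (3,2892873,9181), (3,38983,9773), (3,489183,918771), (3,58948773,91871), (5,0,0),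
        (5,0,0)]])
  | 7 =>
    ([876543210, 875643210, 875634210, 874365210, 874562310, 874365120, 872451630],
     [[(1,2,5), (1,72,773), (1,3,4), (1,771,73), (1,76,772), (1,4,3), (1,772,76),
        (1,773,72), (1,73,771), (1,5,2), (1,71,775), (1,774,75), (1,775,71), (1,7,77),
        (1,6,1), (1,1,6), (1,75,774), (1,776,74), (1,77,7), (1,74,776), (1,0,0), (6,8,0),
        (6,18,6), (6,28,5), (6,38,4), (6,48,3), (6,58,2), (6,68,1), (6,98,9), (6,968,96),
        (6,958,95), (6,948,94), (6,938,93), (6,928,92), (6,918,91), (0,0,0)],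
      [(2,2,5), (4,3,4), (3,76,1), (4,974,92), (1,772,974), (3,71,4), (1,76,9771),
        (4,76,1), (4,96,96), (2,0,0), (5,9774,7), (6,93,773), (5,73,9772), (6,9,7),
        (5,9776,71), (5,77,972), (6,4,973), (5,971,771), (6,0,977), (5,775,973), (0,0,0),
        (1,89,77), (4,1891,974), (2,281,771), (2,38772,772), (1,48,973), (5,5895,773),
        (5,68773,9774), (1,98,7), (2,1898773,775), (2,28984,776), (4,38981,76),
        (1,9383,774), (5,928773,776), (5,68985,977), (1,0,0)],
      [(2,773,971), (3,0,95), (2,776,973), (6,5,771), (5,74,773), (5,974,92), (6,6,72),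
        (5,72,776), (5,92,9771), (1,0,0), (5,4,774), (5,971,9776), (6,94,973),
        (2,74,9776), (2,73,972), (5,75,3), (5,973,9772), (6,93,9774), (2,771,9774),
        (2,72,9772), (1,5,2), (5,871,72), (5,1892,971), (6,2893,9), (2,384,96),
        (4,483,971), (1,5874,76), (1,685,73), (6,8983,5), (5,18982,74), (5,95871,973),
        (1,38985,74), (1,489876,71), (4,9283,74), (2,9184,6), (2,0,0)],
      [(5,95,95), (2,0,95), (5,0,0), (4,93,1), (5,73,73), (1,1,76), (1,775,3),
        (5,9774,9774), (4,94,2), (4,3,91), (4,6,93), (5,771,771), (1,772,6), (1,74,776),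
        (2,771,9774), (1,4,71), (5,972,972), (4,5,94), (2,73,972), (1,7,77), (4,91,4),
        (6,891,95), (4,18976,0), (5,2896,974), (5,38976,9775), (6,4894,974),
        (5,589776,92), (6,6892,9772), (5,8986,71), (4,189876,95), (6,28981,0),
        (6,38982,773), (5,4898776,3), (6,58984,71), (5,689876,77), (3,0,0)],
      [(3,4,91), (5,776,75), (6,91,9773), (5,774,74), (6,93,971), (1,74,776), (1,7,71),
        (3,2,94), (5,76,2), (5,772,776), (5,1,6), (6,9,9), (1,1,76), (1,772,6), (5,71,4),
        (1,775,77), (3,1,93), (5,74,76), (5,5,772), (1,4,3), (5,3,775), (2,873,94),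
        (4,186,95), (5,2894,975), (5,38974,9772), (2,483,9772), (5,589774,94),
        (2,68773,975), (1,898774,75), (3,9686,73), (5,2898,774), (5,38987,5), (1,93876,9),
        (5,589877,72), (1,68984,772), (4,0,0)],
      [(2,776,72), (2,773,74), (3,0,0), (1,972,77), (2,3,75), (4,4,71), (5,71,976),
        (6,4,9775), (5,976,71), (5,6,9773), (1,7,9774), (4,2,76), (2,774,4), (1,771,971),
        (5,1,975), (5,9775,775), (5,775,9775), (6,95,73), (5,9773,6), (4,6,1), (5,975,1),
        (5,84,9774), (6,181,9771), (5,289773,5), (5,38,972), (1,4871,972), (5,582,91),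
        (2,6877,773), (4,8985,75), (3,1898,775), (1,9582,72), (4,94872,94), (5,93875,2),
        (2,58986,776), (6,9185,76), (5,0,0)],
      [(5,73,95), (5,773,9773), (1,977,0), (5,95,771), (4,971,93), (2,71,76), (5,3,976),
        (1,97,7), (1,9,77), (2,72,6), (5,9775,4), (2,1,773), (2,2,73), (1,77,977),
        (4,91,975), (5,975,72), (2,772,775), (4,9,9), (1,0,97), (2,771,5), (1,7,9),
        (0,8,0), (5,189771,1), (5,2891,772), (5,38776,9772), (5,48971,74), (5,5876,91),
        (5,686,974), (6,898,9), (2,18987,774), (2,289877,71), (3,389874,4), (2,4898,2),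
        (3,58984,72), (3,68985,0), (6,0,0)]])
  | 8 =>
    ([876543210, 867543210, 867453210, 867534210, 867452310, 854762310, 867325410, 867452301],
     [[(1,84,38), (1,8,8), (1,184,386), (1,82,58), (1,18,86), (1,284,385), (1,86,18),
        (1,182,586), (1,28,85), (1,384,384), (1,58,82), (1,186,186), (1,282,585),
        (1,38,84), (1,484,383), (1,83,48), (1,68,81), (1,286,185), (1,382,584), (1,48,83),
        (1,584,382), (1,1,6), (1,2,5), (1,3,4), (1,4,3), (1,5,2), (1,6,1), (1,0,0),
        (6,89386,1), (6,189386,0), (6,289386,6), (6,389386,5), (6,489386,4), (6,589386,3),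
        (6,689386,2), (6,9386,18)],
      [(2,73,83), (3,382,7), (2,183,187), (2,6,872), (2,287,71), (2,383,484), (2,482,583),
        (2,4876,582), (2,74,776), (3,0,0), (2,586,5875), (3,872,6), (2,776,74),
        (2,3873,186), (2,0,0), (7,5,38773), (7,72,3875), (7,184,72), (7,774,382),
        (7,287,283), (7,3874,3), (7,4874,2), (7,487,281), (7,773,386), (7,584,75),
        (7,71,387), (7,4,38774), (0,0,0), (2,893,28773), (2,18948,283), (2,2895,58774),
        (2,389773,282), (2,489775,586), (2,58918,184), (7,689483,583), (7,9583,484)],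
      [(4,875,284), (5,4,38), (6,48,1), (4,484,383), (5,1873,48), (4,0,0), (4,18,5874),
        (1,1,5877), (6,286,75), (5,387,684), (4,1873,774), (1,83,73), (6,5,18772),
        (5,2873,286), (1,0,0), (1,187,183), (4,386,487), (5,6,282), (4,485,585),
        (4,38,2873), (4,3874,3), (1,486,8776), (4,482,587), (5,585,1), (4,282,283),
        (4,4,38774), (4,3875,772), (1,484,383), (1,89182,386), (4,189582,3874),
        (5,28981,7), (4,389384,582), (4,489386,4871), (4,58928776,4), (1,6895877,85),
        (1,938,4875)],
      [(5,3874,8), (1,186,582), (5,587,71), (1,584,77), (5,74,484), (1,185,72), (1,6,872),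
        (5,383,776), (1,2,48776), (1,0,0), (5,1,6), (1,285,8), (5,487,285), (5,387,684),
        (5,2873,286), (5,6,18774), (1,3872,85), (5,4,774), (5,18,482), (5,5873,0),
        (1,386,877), (5,3876,1), (1,28,58774), (5,75,3), (5,0,48772), (5,583,86),
        (1,87,184), (1,384,384), (4,8985,776), (4,1895875,583), (4,2896875,1),
        (4,389875,286), (4,4891875,682), (4,5892875,484), (4,6893875,385), (4,94875,18)],
      [(7,0,0), (7,5874,874), (2,2873,38), (7,1871,81), (2,5874,18), (2,0,0), (7,28,487),
        (2,283,282), (2,587,482), (2,487,386), (7,8773,85), (2,585,485), (2,184,8773),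
        (2,48776,75), (2,383,484), (2,284,875), (7,482,28), (7,7,83), (7,385,686),
        (7,2875,483), (7,871,871), (2,3,3874), (7,85,583), (7,181,284), (7,48,77),
        (7,284,875), (7,1873,72), (2,382,4871), (7,89484,774), (2,1894872,3), (3,2898,74),
        (2,389384,582), (2,4892876,284), (2,589873,382), (7,68968,1876), (7,9481,581)],
      [(3,1,3876), (2,282,6), (2,685,5871), (2,1,585), (2,286,2873), (2,486,5876),
        (7,74,383), (7,8772,6), (7,687,85), (7,485,484), (2,48,1873), (2,586,284),
        (3,3,75), (2,3,84), (7,6,481), (7,484,776), (7,1,587), (7,383,283), (7,28,8771),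
        (3,6,1), (7,284,875), (2,48776,83), (2,385,182), (2,38,4), (3,0,5873),
        (7,871,871), (2,684,387), (7,683,1), (7,894,73), (7,1895,5874), (7,289185,0),
        (7,38977,386), (2,4892875,485), (7,589485,384), (2,68985,77), (7,9771,28)],
      [(7,38,84), (2,18772,5), (7,4,382), (2,282,384), (7,285,18), (2,1,48), (2,2,5876),
        (7,584,3), (2,3873,186), (2,184,8773), (2,384,585), (7,86,285), (2,487,386),
        (2,74,776), (2,83,6), (2,75,286), (7,481,581), (2,84,2876), (2,876,486),
        (2,581,181), (2,283,4876), (2,185,774), (7,682,683), (2,1873,72), (2,582,1876),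
        (2,18775,38), (2,183,1877), (2,485,283), (7,89282,4), (0,189,386), (7,289382,184),
        (7,389182,385), (7,48982,83), (7,589482,681), (7,689682,482), (7,9482,28)],
      [(4,0,0), (4,83,7), (1,2,4874), (1,382,774), (4,77,48), (4,875,284), (4,483,2875),
        (5,587,1), (5,383,74), (4,583,85), (5,6,8772), (4,485,1874), (4,28,482),
        (5,85,687), (6,3,584), (1,387,71), (4,687,285), (4,686,385), (1,6876,876),
        (4,85,8773), (5,1,683), (4,8775,74), (1,3,3874), (1,184,871), (4,284,181),
        (5,481,6), (4,487,28), (4,382,4871), (4,89287,585), (5,1895,76), (5,289185,0),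
        (4,38948,75), (1,4895,383), (6,58928,3), (4,6894,682), (5,974,85)]])
  | 9 =>
    ([876543210, 786543210, 785643210, 785634210, 658734120],
     [[(1,8948,8948), (1,8918,8918), (1,18948,89486), (1,8968,8968), (1,18918,89186),
        (1,28948,89485), (1,8928,8928), (1,18968,89686), (1,28918,89185), (1,38948,89484),
        (1,8938,8938), (1,18928,89286), (1,28968,89685), (1,38918,89184), (1,48948,89483),
        (1,8958,8958), (1,18938,89386), (1,28928,89285), (1,38968,89684), (1,48918,89183),
        (1,58948,89482), (1,98,89), (1,968,896), (1,958,895), (1,948,894), (1,938,893),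
        (1,928,892), (1,918,891), (1,8,8), (1,18,86), (1,28,85), (1,38,84), (1,48,83),
        (1,58,82), (1,68,81), (1,0,0)],
      [(2,2,5), (2,72,773), (2,3,4), (2,771,73), (2,76,772), (2,4,3), (2,772,76),
        (2,773,72), (2,73,771), (2,5,2), (2,71,775), (2,774,75), (2,775,71), (2,7,77),
        (2,6,1), (2,1,6), (2,75,774), (2,776,74), (2,77,7), (2,74,776), (2,0,0),
        (4,3893,5872), (4,8973,583), (4,5893,587), (4,28973,581), (4,38973,58),
        (4,1893,5874), (4,2893,5873), (4,1891,3873), (4,2891,3872), (4,1872,9387),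
        (4,4891,387), (4,28772,938), (4,8971,381), (4,18971,38), (0,0,0)],
      [(3,2,5), (3,289871,58), (3,2896875,89181), (3,18983,3876), (1,48968,38928),
        (3,893876,89481), (1,18918,289384), (3,382,689874), (3,189873,386), (3,0,0),
        (3,58986,18), (1,48,898773), (3,3897,894), (1,8,8987), (3,987,987), (3,86,18982),
        (1,4898,873), (3,18987,86), (1,898,877), (3,387,89874), (1,0,0),
        (1,38968,18958772), (3,89483,38), (3,281,771), (3,182,38986), (1,18938,1895872),
        (3,928,81), (3,38,189874), (1,38918,2894871), (3,84,48948), (3,73,685),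
        (3,76,5874), (1,18928,48948771), (3,968,96876), (3,68,892), (1,58948,89482)],
      [(2,189874,38), (2,489871,584), (2,1876,18985), (4,4872,918), (4,2871,68772),
        (4,38958,8), (4,282,9181), (4,18928772,7), (4,8,89584), (2,0,0), (4,7,589487),
        (4,1892,9283), (4,982,68984), (2,86,18987), (2,48984,381), (4,4871,686),
        (4,4892,9286), (4,38981,589), (2,38986,182), (2,898776,18), (2,5,2), (4,1872,687),
        (4,1,895877), (4,9873,386), (2,18,58986), (2,58,289871), (2,5874,76), (2,685,73),
        (4,2873,3896), (4,89387,6), (4,184,48977), (2,38985,74), (2,18982,86),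
        (2,771,281), (2,38,89483), (2,81,928)],
      [(1,8918,589486), (1,18948,28918), (1,18958,48948), (3,91874,182), (3,9181,282),
        (3,68773,181), (3,287,589386), (3,686,4871), (3,585,6891), (3,1898,189282),
        (3,895877,1), (3,2892875,586), (3,89186,589), (1,38,18971), (3,8772,28958),
        (3,9283,1892), (3,58772,8971), (3,58773,891), (3,389187,91), (1,938,28772),
        (3,8,38958), (3,6,89387), (3,982,18918), (3,4872,189684), (3,89585,587),
        (1,918,38774), (3,587,689482), (1,48918,28958772), (3,589487,7), (3,918,4872),
        (3,91877,5872), (1,58,38973), (3,4,28958772), (1,38918,4896871), (3,386,9873),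
        (3,89584,8)]])
  | _ =>
    ([876543210],
     [[(0,94873,0), (0,95,0), (0,68972,0), (0,58771,0), (0,92872,0), (0,9284,0),
        (0,6872,0), (0,9481,0), (0,3892,0), (0,0,0), (0,9183,0), (0,6894,0), (0,689771,0),
        (0,0,0), (0,0,0), (0,4891,0), (0,48973,0), (0,5873,0), (0,0,0), (0,0,0), (0,0,0),
        (0,8977,0), (0,3876,0), (0,28975,0), (0,0,0), (0,0,0), (0,0,0), (0,0,0),
        (0,987,0), (0,689876,0), (0,958775,0), (0,0,0), (0,0,0), (0,0,0), (0,0,0),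
        (0,0,0)]])

lemma checkReps_certifiedReps :
    ∀ k ≤ 9, checkReps k (certifiedReps k).1 (certifiedReps k).2 = true := by
  decide +kernel

section ProjectiveLine

lemma exists_pow_three_eq_add_one : ∃ α : F8, α ^ 3 = α + 1 := by
  have two : (2 : F8) = 0 := CharTwo.two_eq_zero
  have hcard : Nat.card F8 = 8 := GaloisField.card 2 3 (by norm_num)
  have : Finite F8 := Nat.finite_of_card_ne_zero (by simp [hcard])
  have := Fintype.ofFinite F8
  rw [Nat.card_eq_fintype_card] at hcard
  classical
  obtain ⟨x, hx⟩ : ∃ x : F8, x ∉ ({0, 1} : Finset F8) := by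
    by_contra! h
    have := (Finset.card_le_card fun x _ => h x : (Finset.univ : Finset F8).card ≤ _).trans
      Finset.card_le_two
    rw [Finset.card_univ, hcard] at this
    omega
  simp only [Finset.mem_insert, Finset.mem_singleton, not_or] at hx
  have hx7 : x ^ 7 = 1 := by simpa [hcard] using FiniteField.pow_card_sub_one_eq_one x hx.1
  have hprod : (x - 1) * (x ^ 3 - x - 1) * (x ^ 3 - x ^ 2 - 1) = 0 := by
    linear_combination hx7 + (-x ^ 6 + x ^ 3) * two
  simp only [mul_eq_zero, sub_eq_zero, hx.2, false_or] at hprod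
  obtain h | h := hprod
  · exact ⟨x, by linear_combination h⟩
  · refine ⟨x⁻¹, ?_⟩
    have := hx.1
    field_simp
    linear_combination -h - x ^ 2 * two

variable {α : F8}

/-- Representatives of the points of the projective line over `F₈`, in the order used for
`letters`. -/
noncomputable def pointRep (α : F8) : Fin 9 → Fin 2 → F8 :=
  ![![1, 1], ![α, 1], ![α ^ 2, 1], ![α ^ 3, 1], ![α ^ 4, 1], ![α ^ 5, 1], ![α ^ 6, 1],
    ![0, 1], ![1, 0]]

lemma pointRep_ne_zero (i : Fin 9) : pointRep α i ≠ 0 := by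
  fin_cases i <;> simp [pointRep]

/-- The points of the projective line over `F₈`, in the order used for `letters`. -/
noncomputable def point (α : F8) (i : Fin 9) : Projectivization F8 (Fin 2 → F8) :=
  Projectivization.mk F8 (pointRep α i) (pointRep_ne_zero i)

lemma pow_seven_eq_one (hα : α ^ 3 = α + 1) : α ^ 7 = 1 := by
  linear_combination (α ^ 4 + α ^ 2 + α + 1) * hα +
    (α ^ 2 + α) * (CharTwo.two_eq_zero : (2 : F8) = 0)

lemma point_injective (hα : α ^ 3 = α + 1) : Function.Injective (point α) := by
  have h0 : α ≠ 0 := by rintro rfl; simp at hα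
  have h1 : α ≠ 1 := by rintro rfl; simp at hα
  have : Fact (Nat.Prime 7) := ⟨by norm_num⟩
  have hord : orderOf α = 7 := orderOf_eq_prime (pow_seven_eq_one hα) h1
  have hpow : ∀ m < 7, ∀ n < 7, α ^ m = α ^ n → m = n := fun m hm n hn h =>
    pow_injOn_Iio_orderOf (by simpa [hord]) (by simpa [hord]) h
  have hrep (i : Fin 9) (hi : (i : ℕ) < 7) : pointRep α i = ![α ^ (i : ℕ), 1] := by
    fin_cases i <;> simp [pointRep] at hi ⊢
  have hrep7 : pointRep α 7 = ![0, 1] := rfl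
  have hrep8 : pointRep α 8 = ![1, 0] := rfl
  have hcases (i : Fin 9) : (i : ℕ) < 7 ∨ i = 7 ∨ i = 8 := by omega
  intro i j hij
  obtain ⟨c, hc⟩ := (Projectivization.mk_eq_mk_iff' _ _ _ _ _).mp hij
  have hc0 := congrFun hc 0
  have hc1 := congrFun hc 1
  clear hc hij
  obtain hi | rfl | rfl := hcases i <;> obtain hj | rfl | rfl := hcases j <;>
    simp [*] at hc0 hc1 ⊢
  · exact Fin.ext (hpow _ hi _ hj (by simpa [hc1] using hc0.symm))
  · exact (pow_ne_zero _ h0 hc0.symm).elim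
  all_goals simp_all

lemma glProjHom8_mk (M : Matrix.GeneralLinearGroup (Fin 2) F8) (v : Fin 2 → F8) (hv : v ≠ 0)
    (hv' : M.1.mulVec v ≠ 0) :
    glProjHom8 M (Projectivization.mk F8 v hv) = Projectivization.mk F8 (M.1.mulVec v) hv' := by
  rfl

lemma frobProjPerm_mk (v : Fin 2 → F8) (hv : v ≠ 0) (hv' : (fun i => v i ^ 2) ≠ 0) :
    frobProjPerm (Projectivization.mk F8 v hv) = Projectivization.mk F8 (fun i => v i ^ 2) hv' := by
  rfl

/-- `ℙ¹(F₈)` has nine points. -/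
lemma point_bijective (hα : α ^ 3 = α + 1) : Function.Bijective (point α) := by
  have hcard : Nat.card F8 = 8 := GaloisField.card 2 3 (by norm_num)
  have h9 : Nat.card (Projectivization F8 (Fin 2 → F8)) = 9 := by
    rw [Projectivization.card_of_finrank_two F8 _ (by simp), hcard]
  have : Finite (Projectivization F8 (Fin 2 → F8)) :=
    Nat.finite_of_card_ne_zero (by simp [h9])
  rw [Nat.bijective_iff_injective_and_card]
  exact ⟨point_injective hα, by simp [h9]⟩

lemma map_point_eq {g : Perm (Projectivization F8 (Fin 2 → F8))} {L : (Fin 2 → F8) → Fin 2 → F8}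
    (hg : ∀ v hv hv', g (.mk F8 v hv) = .mk F8 (L v) hv') {i j : Fin 9} {c : F8} (hc : c ≠ 0)
    (h : L (pointRep α i) = c • pointRep α j) : g (point α i) = point α j := by
  have h0 : L (pointRep α i) ≠ 0 := by rw [h]; exact smul_ne_zero hc (pointRep_ne_zero j)
  rw [point, point, hg _ _ h0, Projectivization.mk_eq_mk_iff']
  exact ⟨c, h.symm⟩

lemma exists_apply_point_of_det_ne_zero (M : Matrix (Fin 2) (Fin 2) F8) (hM : M.det ≠ 0)
    {f : Fin 9 → Fin 9} {c : Fin 9 → F8} (hc : ∀ i, c i ≠ 0)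
    (h : ∀ i, M.mulVec (pointRep α i) = c i • pointRep α (f i)) :
    ∃ g ∈ pgammal28, ∀ i, g (point α i) = point α (f i) :=
  ⟨glProjHom8 (.mkOfDetNeZero M hM), Subgroup.subset_closure (.inl ⟨_, rfl⟩), fun i =>
    map_point_eq (glProjHom8_mk _) (hc i) (h i)⟩

lemma exists_apply_point_eq_digitMap (hα : α ^ 3 = α + 1) :
    ∀ d < 10, ∃ g ∈ pgammal28, ∀ i, g (point α i) = point α (digitMap (letters.getD d 0) i) := by
  have two : (2 : F8) = 0 := CharTwo.two_eq_zero
  have h7 := pow_seven_eq_one hα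
  have h0 : α ≠ 0 := by rintro rfl; simp at hα
  have hmul : ∃ g ∈ pgammal28, ∀ i, g (point α i) = point α (digitMap 870654321 i) := by
    have hd : digitMap 870654321 = ![1, 2, 3, 4, 5, 6, 0, 7, 8] := by decide
    refine exists_apply_point_of_det_ne_zero !![α, 0; 0, 1] (by simpa)
      (c := ![1, 1, 1, 1, 1, 1, 1, 1, α]) ?_ ?_
    · intro i; fin_cases i <;> simp [h0]
    · intro i
      rw [hd]
      fin_cases i <;> ext j <;> fin_cases j <;> simp [pointRep] <;> grind
  obtain ⟨g, hg, hgp⟩ := hmul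
  have hpow (n : ℕ) (i : Fin 9) : (g ^ n) (point α i) = point α ((digitMap 870654321)^[n] i) := by
    induction n with
    | zero => rfl
    | succ n ih => rw [pow_succ', Perm.mul_apply, ih, hgp, Function.iterate_succ_apply']
  intro d hd
  obtain hd | rfl | rfl | rfl : d < 7 ∨ d = 7 ∨ d = 8 ∨ d = 9 := by omega
  · refine ⟨g ^ d, pow_mem hg d, fun i => ?_⟩
    have : ∀ d < 7, ∀ i, (digitMap 870654321)^[d] i = digitMap (letters.getD d 0) i := by decide
    rw [hpow, this d hd]
  · have hd : digitMap (letters.getD 7 0) = ![0, 2, 4, 6, 1, 3, 5, 7, 8] := by decide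
    refine ⟨frobProjPerm, Subgroup.subset_closure (.inr rfl), fun i =>
      map_point_eq frobProjPerm_mk (one_ne_zero) ?_⟩
    rw [hd]
    have h8 : α ^ 8 = α := by linear_combination α * h7
    have h10 : α ^ 10 = α ^ 3 := by linear_combination α ^ 3 * h7
    have h12 : α ^ 12 = α ^ 5 := by linear_combination α ^ 5 * h7
    fin_cases i <;> ext j <;> fin_cases j <;> simp [pointRep, ← pow_mul, h8, h10, h12]
  · have hd : digitMap (letters.getD 8 0) = ![7, 3, 6, 1, 5, 4, 2, 0, 8] := by decide
    refine exists_apply_point_of_det_ne_zero !![1, 1; 0, 1] (by simp)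
      (c := 1) (by simp) fun i => ?_
    rw [hd]
    fin_cases i <;> ext j <;> fin_cases j <;> simp [pointRep] <;> grind
  · have hd : digitMap (letters.getD 9 0) = ![0, 6, 5, 4, 3, 2, 1, 8, 7] := by decide
    refine exists_apply_point_of_det_ne_zero !![0, 1; 1, 0] (by simp)
      (c := ![1, α, α ^ 2, α ^ 3, α ^ 4, α ^ 5, α ^ 6, 1, 1]) ?_ fun i => ?_
    · intro i; fin_cases i <;> simp [h0]
    · rw [hd]
      fin_cases i <;> ext j <;> fin_cases j <;>
        simp [pointRep, ← pow_succ, ← pow_succ', ← pow_add, h7]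

end ProjectiveLine

lemma ReversibleOn.of_permCongr {α β : Type*} {G : Subgroup (Perm β)} (e : α ≃ β) {x : Perm β}
    {A : Set β} (h : ReversibleOn (G.comap e.permCongrHom.toMonoidHom) (e.symm.permCongr x)
      (e ⁻¹' A)) : ReversibleOn G x A := by
  obtain ⟨u, hu, v, hv, huv⟩ := h
  refine ⟨e.permCongr u, hu, e.permCongr v, hv, fun b hb => ?_⟩
  obtain ⟨a, rfl⟩ := e.surjective b
  obtain ⟨h₁, h₂⟩ := huv a hb
  simp only [permCongr_apply, symm_symm] at h₁ h₂
  simpa [permCongr_apply] using And.intro h₁ h₂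

lemma reversibleOn_pgammal28 (x : Perm (Projectivization F8 (Fin 2 → F8)))
    (A : Set (Projectivization F8 (Fin 2 → F8))) : ReversibleOn pgammal28 x A := by
  obtain ⟨α, hα⟩ := exists_pow_three_eq_add_one
  let e := Equiv.ofBijective _ (point_bijective hα)
  refine .of_permCongr e (reversibleOn_of_checkReps (fun d hd => ?_)
    (fun k hk => ⟨_, _, checkReps_certifiedReps k hk⟩) _ _)
  obtain ⟨g, hg, hgp⟩ := exists_apply_point_eq_digitMap hα d hd
  refine ⟨e.symm.permCongr g, ?_, fun i => ?_⟩
  · have : e.permCongr (e.symm.permCongr g) = g := by ext; simp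
    simpa [Subgroup.mem_comap, this] using hg
  · rw [permCongr_apply, symm_symm, e.symm_apply_eq]
    exact hgp i

end PermutationsOfTheLine

theorem stmt17 (m : ℕ) :
    IsMultFree ((pgammal28.prod (⊤ : Subgroup (Equiv.Perm (Fin m)))).map
      (Equiv.Perm.sumCongrHom (Projectivization F8 (Fin 2 → F8)) (Fin m))) := by
  obtain ⟨α, hα⟩ := exists_pow_three_eq_add_one
  have : Finite (Projectivization F8 (Fin 2 → F8)) := .of_surjective _ (point_bijective hα).2
  exact isMultFree_of_inv_mem_doubleCoset _
    (exists_mul_mul_eq_inv_of_reversibleOn _ reversibleOn_pgammal28)
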